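/- In the singular Minkowski plane (ℝ², N), for every a ∈ ℝ the Busemann function of the ray c(t) = (t, a) is β(x₁,x₂) = |x₂ − a| − x₁; that is, for every (x₁,x₂) ∈ ℝ², lim_{t→+∞}(N(x₁ − t, x₂ − a) − t) = |x₂ − a| − x₁. Moreover, if a ≠ 0 then there is no constant C with |x₂ − a| − x₁ = |x₂| − x₁ + C for all (x₁,x₂) ∈ ℝ²; hence the parallel rays t ↦ (t,0) and t ↦ (t,a), which are asymptotic, define Busemann functions lying in different classes modulo constants. -/

import Mathlib

open Filter

/-- The norm of the singular Minkowski plane. -/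
noncomputable def singN (x : ℝ × ℝ) : ℝ :=
  Real.sqrt (x.1 ^ 2 + 2 * x.2 ^ 2) + |x.2|

/-- The function `s ↦ √(s ^ 2 + b)` is asymptotic to `s` at infinity, up to an error tending
to `0`. -/
theorem tendsto_sqrt_sq_add_sub_self {b : ℝ} (hb : 0 ≤ b) :
    Tendsto (fun s : ℝ => √(s ^ 2 + b) - s) atTop (nhds 0) := by
  refine tendsto_of_tendsto_of_tendsto_of_le_of_le' tendsto_const_nhds
    (tendsto_id.const_div_atTop b) ?_ ?_
  · filter_upwards with s
    exact sub_nonneg.2 (Real.le_sqrt_of_sq_le (by linarith))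
  · filter_upwards [eventually_gt_atTop 0] with s hs
    have hsq : (s + b / s) ^ 2 = s ^ 2 + 2 * b + (b / s) ^ 2 := by
      field_simp
      ring
    rw [id, sub_le_iff_le_add', Real.sqrt_le_left (by positivity), hsq]
    nlinarith [sq_nonneg (b / s)]

/-- In the singular Minkowski plane, the Busemann function of the ray `c t = (t, a)` is
`(x₁,x₂) ↦ |x₂ - a| - x₁`; and for `a ≠ 0` it does not differ from the Busemann function
`|x₂| - x₁` of the parallel ray `t ↦ (t, 0)` by a constant. -/
theorem busemann_of_shifted_horizontal_ray (a : ℝ) :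
    (∀ x : ℝ × ℝ,
      Tendsto (fun t : ℝ => singN (x.1 - t, x.2 - a) - t) atTop
        (nhds (|x.2 - a| - x.1))) ∧
    (a ≠ 0 → ¬ ∃ C : ℝ, ∀ x : ℝ × ℝ, |x.2 - a| - x.1 = |x.2| - x.1 + C) := by
  refine ⟨fun x => ?_, ?_⟩
  · have hs : Tendsto (fun t : ℝ => t - x.1) atTop atTop :=
      tendsto_atTop_add_const_right _ (-x.1) tendsto_id
    have h := ((tendsto_sqrt_sq_add_sub_self
      (show 0 ≤ 2 * (x.2 - a) ^ 2 by positivity)).comp hs).add_const (|x.2 - a| - x.1)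
    rw [zero_add] at h
    refine h.congr fun t => ?_
    simp only [Function.comp_apply, singN, sub_sq_comm t x.1]
    ring
  · rintro ha ⟨C, hC⟩
    have h₀ := hC (0, 0)
    have h₁ := hC (0, a)
    simp only [zero_sub, abs_neg, abs_zero, sub_self] at h₀ h₁
    linarith [abs_pos.2 ha]
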